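/- Let d ∈ ℕ*, α ∈ (0,1), p ∈ (1,2], k ∈ (0,α), and m(x) := ⟨x⟩^k. Then there exist constants C > 0 and c > 0 such that for every u ∈ C_c^∞(ℝ^d): ∫_{ℝ^d} I(u)(x) u(x)^{p−1} m(x)^p dx ≤ C ‖u‖^p_{L^p(m)} − c |(um)^{p/2}|²_{H^{α/2}}, where I(u)(x) := ∫ (u(y)−u(x))/|y−x|^{d+α} dy, (um)^{p/2} denotes the signed power, and |v|²_{H^{α/2}} := ∫_{ℝ^d}∫_{ℝ^d} |v(y)−v(x)|² / |y−x|^{d+α} dy dx is the Gagliardo seminorm. -/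

import Mathlib

open MeasureTheory

/-- Japanese bracket `⟨x⟩ = (1+|x|²)^{1/2}`. -/
noncomputable def jb {d : ℕ} (x : EuclideanSpace ℝ (Fin d)) : ℝ := Real.sqrt (1 + ‖x‖ ^ 2)

/-- Signed power: `z ^ a := |z| ^ (a-1) * z`, with `0 ^ a = 0`. -/
noncomputable def sgnPow (a z : ℝ) : ℝ := |z| ^ (a - 1) * z

lemma sgnPow_of_nonneg {a z : ℝ} (ha : 0 < a) (hz : 0 ≤ z) : sgnPow a z = z ^ a := by
  unfold sgnPow
  rcases hz.eq_or_lt with h | h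
  · subst h; simp [Real.zero_rpow ha.ne']
  · rw [abs_of_pos h]
    nth_rewrite 2 [← Real.rpow_one z]
    rw [← Real.rpow_add h]; ring_nf

lemma sgnPow_neg (a z : ℝ) : sgnPow a (-z) = - sgnPow a z := by
  unfold sgnPow; rw [abs_neg]; ring

lemma abs_sgnPow {a : ℝ} (ha : 0 < a) (z : ℝ) : |sgnPow a z| = |z| ^ a := by
  rw [← sgnPow_of_nonneg ha (abs_nonneg z)]
  unfold sgnPow
  rw [abs_mul, abs_abs, abs_of_nonneg (Real.rpow_nonneg (abs_nonneg z) _)]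

lemma sgnPow_mul_pos {a z m : ℝ} (hm : 0 < m) : sgnPow a (z * m) = sgnPow a z * m ^ a := by
  unfold sgnPow
  have h : m ^ a = m ^ (a - 1) * m := by
    nth_rewrite 3 [← Real.rpow_one m]
    rw [← Real.rpow_add hm]; ring_nf
  rw [abs_mul, abs_of_pos hm, Real.mul_rpow (abs_nonneg z) hm.le, h]; ring

lemma measurable_sgnPow (a : ℝ) : Measurable (sgnPow a) := by
  unfold sgnPow; fun_prop

/-- the case `a ≥ b ≥ 0`. -/
lemma sv_nonneg {p a b : ℝ} (hp : 1 < p) (hp2 : p ≤ 2) (hb : 0 ≤ b) (hab : b ≤ a) :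
    (p - 1) / 2 * (a ^ (p / 2) - b ^ (p / 2)) ^ 2 ≤ (a - b) * (a ^ (p - 1) - b ^ (p - 1)) := by
  rcases (hb.trans hab).eq_or_lt with h | ha
  · have : b = a := by linarith
    subst this; simp
  obtain ⟨t, rfl⟩ : ∃ t, b = a * t := ⟨b / a, by field_simp⟩
  have ht0 : 0 ≤ t := by
    by_contra h; push Not at h
    nlinarith [mul_neg_of_pos_of_neg ha h]
  have ht1 : t ≤ 1 := by
    by_contra h; push Not at h
    nlinarith [mul_lt_mul_of_pos_left h ha]
  rw [Real.mul_rpow ha.le ht0, Real.mul_rpow ha.le ht0]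
  have e1 : (a ^ (p / 2)) ^ 2 = a ^ p := by
    rw [← Real.rpow_natCast, ← Real.rpow_mul ha.le]; norm_num
  have e2 : a * a ^ (p - 1) = a ^ p := by
    nth_rewrite 1 [← Real.rpow_one a]
    rw [← Real.rpow_add ha]; ring_nf
  have h1 : t ≤ t ^ (p / 2) := by
    rcases ht0.eq_or_lt with h | h
    · subst h; simp [Real.zero_rpow (show p / 2 ≠ 0 by linarith)]
    · simpa using Real.rpow_le_rpow_of_exponent_ge h ht1 (show p / 2 ≤ 1 by linarith)
  have h1' : t ^ (p / 2) ≤ 1 := Real.rpow_le_one ht0 ht1 (by linarith)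
  have h2 : t ^ (p - 1) ≤ 1 + (p - 1) * (t - 1) := by
    have := rpow_one_add_le_one_add_mul_self (s := t - 1) (by linarith)
      (show 0 ≤ p - 1 by linarith) (by linarith)
    simpa using this
  have key : (p - 1) / 2 * (1 - t ^ (p / 2)) ^ 2 ≤ (1 - t) * (1 - t ^ (p - 1)) := by
    have s1 : (1 - t ^ (p / 2)) ^ 2 ≤ (1 - t) ^ 2 := by
      apply pow_le_pow_left₀ <;> linarith
    have s2 : (1 - t) * ((p - 1) * (1 - t)) ≤ (1 - t) * (1 - t ^ (p - 1)) := by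
      apply mul_le_mul_of_nonneg_left <;> linarith
    have s3 := mul_le_mul_of_nonneg_left s1 (show 0 ≤ (p - 1) / 2 by linarith)
    have s4 : 0 ≤ (p - 1) * (1 - t) ^ 2 := mul_nonneg (by linarith) (sq_nonneg _)
    nlinarith
  have := mul_le_mul_of_nonneg_left key (Real.rpow_nonneg ha.le p)
  calc _ = (a ^ (p / 2)) ^ 2 * ((p - 1) / 2 * (1 - t ^ (p / 2)) ^ 2) := by ring
    _ ≤ a ^ p * ((1 - t) * (1 - t ^ (p - 1))) := by rw [e1]; exact this
    _ = _ := by rw [← e2]; ring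

lemma rpow_mul_self' {p a : ℝ} (hp : 1 < p) (ha : 0 ≤ a) : a * a ^ (p - 1) = a ^ p := by
  rcases ha.eq_or_lt with h | h
  · subst h; simp [Real.zero_rpow (show p ≠ 0 by linarith)]
  · nth_rewrite 1 [← Real.rpow_one a]
    rw [← Real.rpow_add h]; ring_nf

lemma sv_opp {p a b : ℝ} (hp : 1 < p) (hp2 : p ≤ 2) (hb : 0 ≤ b) (ha : 0 ≤ a) :
    (p - 1) / 2 * (a ^ (p / 2) + b ^ (p / 2)) ^ 2 ≤ (a + b) * (a ^ (p - 1) + b ^ (p - 1)) := by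
  have e (a : ℝ) (ha : 0 ≤ a) : (a ^ (p / 2)) ^ 2 = a * a ^ (p - 1) := by
    rw [rpow_mul_self' hp ha, ← Real.rpow_natCast, ← Real.rpow_mul ha]; norm_num
  have e1 := e a ha
  have e2 := e b hb
  have n1 := mul_nonneg ha (Real.rpow_nonneg hb (p - 1))
  have n2 := mul_nonneg hb (Real.rpow_nonneg ha (p - 1))
  have : (p - 1) / 2 * (a ^ (p / 2) + b ^ (p / 2)) ^ 2
      ≤ 1 / 2 * (a ^ (p / 2) + b ^ (p / 2)) ^ 2 := by
    apply mul_le_mul_of_nonneg_right (by linarith) (sq_nonneg _)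
  nlinarith [sq_nonneg (a ^ (p / 2) - b ^ (p / 2))]

/-- Stroock–Varopoulos type inequality. -/
lemma sv {p : ℝ} (hp : 1 < p) (hp2 : p ≤ 2) (a b : ℝ) :
    (p - 1) / 2 * (sgnPow (p / 2) a - sgnPow (p / 2) b) ^ 2
      ≤ (a - b) * (sgnPow (p - 1) a - sgnPow (p - 1) b) := by
  have q1 : 0 < p / 2 := by linarith
  have q2 : 0 < p - 1 := by linarith
  have pos (a b : ℝ) (ha : 0 ≤ a) (hb : 0 ≤ b) : (p - 1) / 2 * (sgnPow (p / 2) a - sgnPow (p / 2) b) ^ 2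
      ≤ (a - b) * (sgnPow (p - 1) a - sgnPow (p - 1) b) := by
    rw [sgnPow_of_nonneg q1 ha, sgnPow_of_nonneg q1 hb, sgnPow_of_nonneg q2 ha,
      sgnPow_of_nonneg q2 hb]
    rcases le_total b a with h | h
    · exact sv_nonneg hp hp2 hb h
    · have := sv_nonneg hp hp2 ha h
      linarith
  have opp (a b : ℝ) (ha : 0 ≤ a) (hb : 0 ≤ b) :
      (p - 1) / 2 * (sgnPow (p / 2) a + sgnPow (p / 2) b) ^ 2
      ≤ (a + b) * (sgnPow (p - 1) a + sgnPow (p - 1) b) := by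
    rw [sgnPow_of_nonneg q1 ha, sgnPow_of_nonneg q1 hb, sgnPow_of_nonneg q2 ha,
      sgnPow_of_nonneg q2 hb]
    exact sv_opp hp hp2 hb ha
  rcases le_total 0 a with ha | ha <;> rcases le_total 0 b with hb | hb
  · exact pos a b ha hb
  · have := opp a (-b) ha (by linarith)
    simp only [sgnPow_neg] at this
    linarith
  · have := opp (-a) b (by linarith) hb
    simp only [sgnPow_neg] at this
    linarith
  · have := pos (-a) (-b) (by linarith) (by linarith)
    simp only [sgnPow_neg] at this
    linarith

lemma one_le_jb {d : ℕ} (x : EuclideanSpace ℝ (Fin d)) : 1 ≤ jb x := by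
  unfold jb; rw [Real.one_le_sqrt]; nlinarith [sq_nonneg ‖x‖]

lemma jb_sub_le {d : ℕ} (x y : EuclideanSpace ℝ (Fin d)) : jb x - jb y ≤ ‖y - x‖ := by
  have h : ‖x‖ ≤ ‖y‖ + ‖y - x‖ := by
    have := norm_sub_norm_le x y
    rw [norm_sub_rev] at this; linarith
  have hy : ‖y‖ ≤ jb y := by
    unfold jb; apply Real.le_sqrt_of_sq_le; linarith
  have hy2 : jb y ^ 2 = 1 + ‖y‖ ^ 2 := by
    unfold jb; rw [Real.sq_sqrt]; positivity
  have := norm_nonneg (y - x)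
  have h1 := one_le_jb y
  have : jb x ≤ jb y + ‖y - x‖ := by
    rw [jb, Real.sqrt_le_left (by linarith)]
    have : ‖x‖ ^ 2 ≤ (‖y‖ + ‖y - x‖) ^ 2 := pow_le_pow_left₀ (norm_nonneg _) h 2
    nlinarith
  linarith

lemma rpow_sub_le_aux {k s t r : ℝ} (hk : 0 < k) (hk1 : k < 1) (ht : 1 ≤ t) (hts : t ≤ s)
    (hr : s - t ≤ r) : s ^ k - t ^ k ≤ min r (r ^ k) := by
  apply le_min
  · refine le_trans ?_ hr
    have ht0 : 0 < t := by linarith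
    have h := rpow_one_add_le_one_add_mul_self (s := (s - t) / t)
      (by have : 0 ≤ (s - t) / t := div_nonneg (by linarith) ht0.le
          linarith) hk.le hk1.le
    have e : s = t * (1 + (s - t) / t) := by field_simp; ring
    have n : 0 ≤ (s - t) / t := div_nonneg (by linarith) ht0.le
    have h3 : s ^ k = t ^ k * (1 + (s - t) / t) ^ k := by
      rw [← Real.mul_rpow ht0.le (by linarith), ← e]
    have h4 : t ^ k ≤ t := by
      simpa using Real.rpow_le_rpow_of_exponent_le ht hk1.le
    have h5 : 0 ≤ t ^ k := Real.rpow_nonneg ht0.le _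
    calc s ^ k - t ^ k = t ^ k * ((1 + (s - t) / t) ^ k - 1) := by rw [h3]; ring
      _ ≤ t ^ k * ((s - t) / t) := by
        apply mul_le_mul_of_nonneg_left _ h5
        nlinarith
      _ ≤ t * ((s - t) / t) := mul_le_mul_of_nonneg_right h4 n
      _ = s - t := by field_simp
  · have h := Real.rpow_add_le_add_rpow (show 0 ≤ t by linarith) (sub_nonneg.2 hts) hk.le hk1.le
    have h2 : (s - t) ^ k ≤ r ^ k := Real.rpow_le_rpow (by linarith) hr hk.le
    rw [show t + (s - t) = s by ring] at h
    linarith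

lemma abs_weight_sub_le {d : ℕ} {k : ℝ} (hk : 0 < k) (hk1 : k < 1)
    (x y : EuclideanSpace ℝ (Fin d)) :
    |jb x ^ k - jb y ^ k| ≤ min ‖y - x‖ (‖y - x‖ ^ k) := by
  rcases le_total (jb y) (jb x) with h | h
  · rw [abs_of_nonneg (sub_nonneg.2 (Real.rpow_le_rpow (by linarith [one_le_jb y]) h hk.le))]
    exact rpow_sub_le_aux hk hk1 (one_le_jb y) h (jb_sub_le x y)
  · rw [abs_sub_comm,
      abs_of_nonneg (sub_nonneg.2 (Real.rpow_le_rpow (by linarith [one_le_jb x]) h hk.le))]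
    have := jb_sub_le y x
    rw [norm_sub_rev] at this
    exact rpow_sub_le_aux hk hk1 (one_le_jb x) h this

lemma continuous_jb {d : ℕ} : Continuous (jb : EuclideanSpace ℝ (Fin d) → ℝ) := by
  unfold jb; fun_prop

lemma continuous_weight {d : ℕ} (k : ℝ) :
    Continuous (fun x : EuclideanSpace ℝ (Fin d) => jb x ^ k) :=
  continuous_jb.rpow_const (fun x => Or.inl (by linarith [one_le_jb x]))

/-- Truncated singular kernel. -/
noncomputable def ker {d : ℕ} (α a : ℝ) (z : EuclideanSpace ℝ (Fin d)) : ℝ :=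
  min ‖z‖ (‖z‖ ^ a) / ‖z‖ ^ ((d : ℝ) + α)

lemma ker_nonneg {d : ℕ} (α a : ℝ) (z : EuclideanSpace ℝ (Fin d)) : 0 ≤ ker α a z := by
  unfold ker; positivity

lemma ker_sub_comm {d : ℕ} (α a : ℝ) (x y : EuclideanSpace ℝ (Fin d)) :
    ker α a (x - y) = ker α a (y - x) := by
  unfold ker; rw [norm_sub_rev]

lemma integrable_ker {d : ℕ} (hd : 0 < d) {α a : ℝ} (hα1 : α < 1) (haα : a < α) :
    Integrable (ker α a : EuclideanSpace ℝ (Fin d) → ℝ) := by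
  have : Nonempty (Fin d) := ⟨⟨0, hd⟩⟩
  have := (integrable_fun_norm_addHaar (E := EuclideanSpace ℝ (Fin d)) volume
    (f := fun r : ℝ => min r (r ^ a) / r ^ ((d : ℝ) + α))).2 ?_
  · exact this
  rw [finrank_euclideanSpace_fin]
  have ed : ((d - 1 : ℕ) : ℝ) = (d : ℝ) - 1 := by
    rw [Nat.cast_sub hd]; simp
  have meas : Measurable (fun y : ℝ => y ^ (d - 1) • (min y (y ^ a) / y ^ ((d : ℝ) + α))) := by
    simp only [smul_eq_mul]
    fun_prop
  rw [← Set.Ioc_union_Ioi_eq_Ioi (zero_le_one (α := ℝ)), integrableOn_union]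
  constructor
  · have h : IntegrableOn (fun y : ℝ => y ^ (-α)) (Set.Ioc 0 1) := by
      have := (intervalIntegral.intervalIntegrable_rpow' (a := 0) (b := 1) (r := -α) (by linarith))
      rwa [intervalIntegrable_iff_integrableOn_Ioc_of_le zero_le_one] at this
    refine h.mono' meas.aestronglyMeasurable ?_
    filter_upwards [ae_restrict_mem measurableSet_Ioc] with y hy
    have hy0 := hy.1
    rw [Real.norm_of_nonneg (by simp only [smul_eq_mul]; positivity), smul_eq_mul]
    calc y ^ (d - 1) * (min y (y ^ a) / y ^ ((d : ℝ) + α))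
        ≤ y ^ (d - 1) * (y / y ^ ((d : ℝ) + α)) := by gcongr; exact min_le_left _ _
      _ = y ^ (-α) := by
        rw [← Real.rpow_natCast, ed]
        nth_rewrite 2 [← Real.rpow_one y]
        rw [← Real.rpow_sub hy0, ← Real.rpow_add hy0]; ring_nf
  · have h : IntegrableOn (fun y : ℝ => y ^ (a - 1 - α)) (Set.Ioi 1) :=
      integrableOn_Ioi_rpow_of_lt (by linarith) one_pos
    refine h.mono' meas.aestronglyMeasurable ?_
    filter_upwards [ae_restrict_mem measurableSet_Ioi] with y hy
    have hy0 : 0 < y := lt_trans one_pos hy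
    rw [Real.norm_of_nonneg (by simp only [smul_eq_mul]; positivity), smul_eq_mul]
    calc y ^ (d - 1) * (min y (y ^ a) / y ^ ((d : ℝ) + α))
        ≤ y ^ (d - 1) * (y ^ a / y ^ ((d : ℝ) + α)) := by gcongr; exact min_le_right _ _
      _ = y ^ (a - 1 - α) := by
        rw [← Real.rpow_natCast, ed]
        rw [← Real.rpow_sub hy0, ← Real.rpow_add hy0]; ring_nf

lemma integrable_ker_prod {d : ℕ} (hd : 0 < d) {α a : ℝ} (hα1 : α < 1) (haα : a < α)
    {f : EuclideanSpace ℝ (Fin d) → ℝ} (hf : Integrable f) :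
    Integrable (fun q : EuclideanSpace ℝ (Fin d) × EuclideanSpace ℝ (Fin d) =>
      ker α a (q.2 - q.1) * f q.1) (volume.prod volume) := by
  have h := Integrable.convolution_integrand (ContinuousLinearMap.mul ℝ ℝ) hf
    (integrable_ker (d := d) hd hα1 haα)
  have h2 := h.swap
  refine h2.congr (Filter.Eventually.of_forall fun q => ?_)
  simp [mul_comm]

lemma integral_ker_prod {d : ℕ} (hd : 0 < d) {α a : ℝ} (hα1 : α < 1) (haα : a < α)
    {f : EuclideanSpace ℝ (Fin d) → ℝ} (hf : Integrable f) :
    ∫ q : EuclideanSpace ℝ (Fin d) × EuclideanSpace ℝ (Fin d),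
      ker α a (q.2 - q.1) * f q.1 ∂(volume.prod volume)
      = (∫ z : EuclideanSpace ℝ (Fin d), ker α a z) * ∫ x, f x := by
  rw [integral_prod _ (integrable_ker_prod hd hα1 haα hf)]
  simp only [integral_mul_const]
  rw [← integral_const_mul]
  congr 1; ext x
  rw [integral_sub_right_eq_self (fun z => ker α a z) x]

/-- The pointwise inequality for the symmetrized integrand. -/
lemma pointwise_ineq {d : ℕ} {α p k : ℝ} (hα : 0 < α ∧ α < 1)
    (hp : 1 < p ∧ p ≤ 2) (hk : 0 < k ∧ k < α) (u : EuclideanSpace ℝ (Fin d) → ℝ)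
    (x y : EuclideanSpace ℝ (Fin d)) :
    (u y - u x) / ‖y - x‖ ^ ((d : ℝ) + α) * (sgnPow (p - 1) (u x) * (jb x ^ k) ^ p)
    + (u x - u y) / ‖x - y‖ ^ ((d : ℝ) + α) * (sgnPow (p - 1) (u y) * (jb y ^ k) ^ p)
    + (p - 1) / 2 * ((sgnPow (p / 2) (u y * jb y ^ k) - sgnPow (p / 2) (u x * jb x ^ k)) ^ 2 /
            ‖y - x‖ ^ ((d : ℝ) + α))
    ≤ 2 * (ker α k (y - x) * (|u x| * jb x ^ k) ^ p
      + ker α k (x - y) * (|u y| * jb y ^ k) ^ p) := by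
  obtain ⟨hp1, hp2⟩ := hp
  rw [ker_sub_comm α k x y, norm_sub_rev x y]
  have hK : 0 ≤ (‖y - x‖ ^ ((d : ℝ) + α))⁻¹ := by positivity
  have hw := abs_weight_sub_le hk.1 (hk.2.trans hα.2) x y
  have hker : ker α k (y - x) = min ‖y - x‖ (‖y - x‖ ^ k) * (‖y - x‖ ^ ((d : ℝ) + α))⁻¹ := by
    unfold ker; rw [div_eq_mul_inv]
  rw [hker]
  simp only [div_eq_mul_inv _ (‖y - x‖ ^ ((d : ℝ) + α))]
  generalize (‖y - x‖ ^ ((d : ℝ) + α))⁻¹ = K at *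
  generalize min ‖y - x‖ (‖y - x‖ ^ k) = ω at *
  have hm : 1 ≤ jb x ^ k := Real.one_le_rpow (one_le_jb x) hk.1.le
  have hn : 1 ≤ jb y ^ k := Real.one_le_rpow (one_le_jb y) hk.1.le
  generalize jb x ^ k = m at *
  generalize jb y ^ k = n at *
  generalize u x = a at *
  generalize u y = b at *
  have hω : 0 ≤ ω := (abs_nonneg _).trans hw
  have hm0 : 0 < m := by linarith
  have hn0 : 0 < n := by linarith
  have hS (a m : ℝ) (hm : 0 < m) : sgnPow (p - 1) a * m ^ p = sgnPow (p - 1) (a * m) * m := by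
    rw [sgnPow_mul_pos hm, ← rpow_mul_self' hp1 hm.le]; ring
  rw [hS a m hm0, hS b n hn0]
  have h0 := sv hp1 hp2 (b * n) (a * m)
  have hA : |sgnPow (p - 1) (a * m)| = (|a| * m) ^ (p - 1) := by
    rw [abs_sgnPow (by linarith), abs_mul, abs_of_pos hm0]
  have hB : |sgnPow (p - 1) (b * n)| = (|b| * n) ^ (p - 1) := by
    rw [abs_sgnPow (by linarith), abs_mul, abs_of_pos hn0]
  have hyoung (s t : ℝ) (hs : 0 ≤ s) (ht : 0 ≤ t) : s * t ^ (p - 1) ≤ s ^ p + t ^ p := by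
    rcases le_total s t with h | h
    · calc s * t ^ (p - 1) ≤ t * t ^ (p - 1) := by gcongr
        _ = t ^ p := rpow_mul_self' hp1 ht
        _ ≤ _ := by have := Real.rpow_nonneg hs p; linarith
    · calc s * t ^ (p - 1) ≤ s * s ^ (p - 1) := by
            have : t ^ (p - 1) ≤ s ^ (p - 1) := Real.rpow_le_rpow ht h (by linarith)
            gcongr
        _ = s ^ p := rpow_mul_self' hp1 hs
        _ ≤ _ := by have := Real.rpow_nonneg ht p; linarith
  have rem (a m b n S : ℝ) (hm : 1 ≤ m) (hn : 1 ≤ n) (hw : |m - n| ≤ ω)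
      (hA : |S| = (|a| * m) ^ (p - 1)) :
      b * (m - n) * S ≤ ω * ((|a| * m) ^ p + (|b| * n) ^ p) := by
    have hm0 : 0 < m := by linarith
    have hn0 : 0 < n := by linarith
    calc b * (m - n) * S ≤ |b * (m - n) * S| := le_abs_self _
      _ = |b| * |m - n| * (|a| * m) ^ (p - 1) := by rw [abs_mul, abs_mul, hA]
      _ ≤ (|b| * n) * ω * (|a| * m) ^ (p - 1) := by
        have : |b| ≤ |b| * n := le_mul_of_one_le_right (abs_nonneg _) hn
        gcongr
      _ = ω * ((|b| * n) * (|a| * m) ^ (p - 1)) := by ring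
      _ ≤ _ := by
        apply mul_le_mul_of_nonneg_left _ hω
        have := hyoung (|b| * n) (|a| * m) (by positivity) (by positivity)
        linarith
  have r1 := rem a m b n _ hm hn hw hA
  have r2 := rem b n a m _ hn hm (by rwa [abs_sub_comm]) hB
  generalize sgnPow (p - 1) (a * m) = S at *
  generalize sgnPow (p - 1) (b * n) = T at *
  have main : (b - a) * (S * m) + (a - b) * (T * n)
     + (p - 1) / 2 * (sgnPow (p / 2) (b * n) - sgnPow (p / 2) (a * m)) ^ 2
     ≤ 2 * (ω * ((|a| * m) ^ p + (|b| * n) ^ p)) := by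
    nlinarith
  have := mul_le_mul_of_nonneg_right main hK
  linarith

lemma integrable_main {d : ℕ} (hd : 0 < d) {α p k : ℝ} (hα : 0 < α ∧ α < 1)
    (hp : 1 < p ∧ p ≤ 2) (u : EuclideanSpace ℝ (Fin d) → ℝ)
    (hu : ContDiff ℝ (⊤ : ℕ∞) u) (hc : HasCompactSupport u) :
    Integrable (fun q : EuclideanSpace ℝ (Fin d) × EuclideanSpace ℝ (Fin d) =>
      (u q.2 - u q.1) / ‖q.2 - q.1‖ ^ ((d : ℝ) + α) *
        (sgnPow (p - 1) (u q.1) * (jb q.1 ^ k) ^ p)) (volume.prod volume) := by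
  have hcont := hu.continuous
  obtain ⟨L, hL⟩ := hu.lipschitzWith_of_hasCompactSupport hc (by simp)
  obtain ⟨M, hM⟩ := hc.exists_bound_of_continuous hcont
  have hM0 : 0 ≤ M := (norm_nonneg _).trans (hM 0)
  have hf : Integrable (fun x => |u x| ^ (p - 1) * (jb x ^ k) ^ p) := by
    apply Continuous.integrable_of_hasCompactSupport
    · apply Continuous.mul
      · exact hcont.abs.rpow_const (fun x => Or.inr (by linarith))
      · exact (continuous_weight k).rpow_const (fun x => Or.inr (by linarith))
    · apply HasCompactSupport.mul_right
      refine hc.comp_left (g := fun z : ℝ => |z| ^ (p - 1)) ?_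
      simp only [abs_zero]
      rw [Real.zero_rpow (by linarith)]
  have hG := (integrable_ker_prod (a := 0) hd hα.2 hα.1 hf).const_mul ((L : ℝ) + 2 * M)
  refine hG.mono' ?_ (Filter.Eventually.of_forall fun q => ?_)
  · apply Measurable.aestronglyMeasurable
    have := hcont.measurable
    have := measurable_sgnPow (p - 1)
    have := (continuous_jb (d := d)).measurable
    fun_prop
  · have hw : 0 ≤ jb q.1 ^ k := Real.rpow_nonneg (by linarith [one_le_jb q.1]) _
    rw [norm_mul, norm_mul, norm_div, Real.norm_eq_abs (sgnPow _ _), abs_sgnPow (by linarith),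
      Real.norm_of_nonneg (Real.rpow_nonneg hw p),
      Real.norm_of_nonneg (Real.rpow_nonneg (norm_nonneg _) _)]
    have h : ‖u q.2 - u q.1‖ ≤ ((L : ℝ) + 2 * M) * min ‖q.2 - q.1‖ (‖q.2 - q.1‖ ^ (0 : ℝ)) := by
      have h1 := hL.norm_sub_le q.2 q.1
      have h2 : ‖u q.2 - u q.1‖ ≤ 2 * M := (norm_sub_le _ _).trans (by linarith [hM q.1, hM q.2])
      have := L.coe_nonneg
      have := norm_nonneg (q.2 - q.1)
      rw [Real.rpow_zero]
      rcases min_cases ‖q.2 - q.1‖ 1 with h | h <;> rw [h.1] <;> nlinarith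
    unfold ker
    calc _ ≤ (((L : ℝ) + 2 * M) * min ‖q.2 - q.1‖ (‖q.2 - q.1‖ ^ (0 : ℝ))) /
            ‖q.2 - q.1‖ ^ ((d : ℝ) + α) * (|u q.1| ^ (p - 1) * (jb q.1 ^ k) ^ p) := by
          gcongr
      _ = _ := by ring

theorem stmt12 (d : ℕ) (hd : 0 < d) (α p k : ℝ) (hα : 0 < α ∧ α < 1)
    (hp : 1 < p ∧ p ≤ 2) (hk : 0 < k ∧ k < α) :
    ∃ C c : ℝ, 0 < C ∧ 0 < c ∧
      ∀ u : EuclideanSpace ℝ (Fin d) → ℝ, ContDiff ℝ (⊤ : ℕ∞) u → HasCompactSupport u →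
      (∫ x : EuclideanSpace ℝ (Fin d),
          (∫ y : EuclideanSpace ℝ (Fin d), (u y - u x) / ‖y - x‖ ^ ((d : ℝ) + α)) *
            sgnPow (p - 1) (u x) * (jb x ^ k) ^ p) ≤
        C * (∫ x : EuclideanSpace ℝ (Fin d), (|u x| * jb x ^ k) ^ p) -
        c * ∫ x : EuclideanSpace ℝ (Fin d), ∫ y : EuclideanSpace ℝ (Fin d),
          (sgnPow (p / 2) (u y * jb y ^ k) - sgnPow (p / 2) (u x * jb x ^ k)) ^ 2 /
            ‖y - x‖ ^ ((d : ℝ) + α) := by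
  have hA : 0 ≤ ∫ z : EuclideanSpace ℝ (Fin d), ker α k z := integral_nonneg (ker_nonneg α k)
  refine ⟨2 * (∫ z : EuclideanSpace ℝ (Fin d), ker α k z) + 1, (p - 1) / 4, by linarith,
    by linarith, fun u hu hc => ?_⟩
  have hcont := hu.continuous
  have hF := integrable_main (k := k) hd hα hp u hu hc
  have hf : Integrable (fun x => (|u x| * jb x ^ k) ^ p) := by
    apply Continuous.integrable_of_hasCompactSupport
    · exact (hcont.abs.mul (continuous_weight k)).rpow_const (fun x => Or.inr (by linarith))
    · have h1 : HasCompactSupport (fun x => |u x| * jb x ^ k) :=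
        HasCompactSupport.mul_right (hc.comp_left (g := fun z : ℝ => |z|) abs_zero)
      exact h1.comp_left (g := fun z : ℝ => z ^ p) (Real.zero_rpow (by linarith))
  have hf0 : 0 ≤ ∫ x, (|u x| * jb x ^ k) ^ p := integral_nonneg fun x => by
    have : 0 ≤ jb x ^ k := Real.rpow_nonneg (by linarith [one_le_jb x]) _
    positivity
  have hG := integrable_ker_prod hd hα.2 hk.2 hf
  have hGi := integral_ker_prod hd hα.2 hk.2 hf
  have hGs := hG.swap
  have hFs := hF.swap
  have hGsi : _ = _ := integral_prod_swap (μ := (volume : Measure (EuclideanSpace ℝ (Fin d))))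
    (ν := (volume : Measure (EuclideanSpace ℝ (Fin d))))
    (fun q : EuclideanSpace ℝ (Fin d) × EuclideanSpace ℝ (Fin d) =>
      ker α k (q.2 - q.1) * (|u q.1| * jb q.1 ^ k) ^ p)
  have hFsi : _ = _ := integral_prod_swap (μ := (volume : Measure (EuclideanSpace ℝ (Fin d))))
    (ν := (volume : Measure (EuclideanSpace ℝ (Fin d))))
    (fun q : EuclideanSpace ℝ (Fin d) × EuclideanSpace ℝ (Fin d) =>
      (u q.2 - u q.1) / ‖q.2 - q.1‖ ^ ((d : ℝ) + α) *
        (sgnPow (p - 1) (u q.1) * (jb q.1 ^ k) ^ p))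
  simp only [Prod.fst_swap, Prod.snd_swap, Function.comp_def] at hGsi hFsi hGs hFs
  have hpt := fun q : EuclideanSpace ℝ (Fin d) × EuclideanSpace ℝ (Fin d) =>
    pointwise_ineq hα hp hk u q.1 q.2
  have hN : Integrable (fun q : EuclideanSpace ℝ (Fin d) × EuclideanSpace ℝ (Fin d) =>
      (p - 1) / 2 * ((sgnPow (p / 2) (u q.2 * jb q.2 ^ k) - sgnPow (p / 2) (u q.1 * jb q.1 ^ k)) ^ 2 /
            ‖q.2 - q.1‖ ^ ((d : ℝ) + α))) (volume.prod volume) := by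
    refine (((hG.add hGs).const_mul 2).sub (hF.add hFs)).mono' ?_
      (Filter.Eventually.of_forall fun q => ?_)
    · apply Measurable.aestronglyMeasurable
      have := hcont.measurable
      have := measurable_sgnPow (p / 2)
      have := (continuous_jb (d := d)).measurable
      fun_prop
    · rw [Real.norm_of_nonneg (mul_nonneg (by linarith) (by positivity))]
      have := hpt q
      simp only [Pi.sub_apply, Pi.add_apply]
      linarith
  have hint := integral_mono ((hF.add hFs).add hN) ((hG.add hGs).const_mul 2) hpt
  rw [integral_const_mul] at hint
  simp only [Pi.add_apply] at hint
  rw [integral_add (by exact hF.add hFs) hN, integral_add hF hFs, integral_add hG hGs, hGsi, hFsi, hGi,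
    integral_prod _ hF, integral_prod _ hN] at hint
  simp only [integral_mul_const, integral_const_mul] at hint
  simp only [mul_assoc]
  linarith
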